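/- Fix θ > 0 and integers N > m ≥ 1. Let a(N) ∈ 𝒫_N, and let 𝕄^{a(N),θ}_m denote the pushforward of the orbital beta process 𝕄^{a(N),θ} under the projection to its m-th level (a^{(m)}_1, …, a^{(m)}_m) ∈ 𝒲_m. Then for all complex numbers y_1, …, y_m ∈ ℂ: 𝔼_{(x_1, …, x_m) ∼ 𝕄^{a(N),θ}_m}[ 𝓑_{(x_1, …, x_m)}(y_1, …, y_m; θ) ] = 𝓑_{a(N)}(y_1, …, y_m, 0^{N−m}; θ), where the Bessel function of the random level is defined almost surely (the level is almost surely strictly ordered). -/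

import Mathlib

open MeasureTheory Filter Topology
open scoped ENNReal

noncomputable section

/-- A triangular array with `M` levels: for `k : Fin M`, level `k+1` has `k+1` real entries. -/
abbrev Tri (M : ℕ) := ∀ k : Fin M, Fin (k.1 + 1) → ℝ

/-- `Interlaces u v` means `u ≺ v`, i.e. `v 1 > u 1 > v 2 > u 2 > ⋯ > v n > u n > v (n+1)`. -/
def Interlaces {n : ℕ} (u : Fin n → ℝ) (v : Fin (n + 1) → ℝ) : Prop :=
  ∀ i : Fin n, u i < v i.castSucc ∧ v i.succ < u i

/-- Level `k+1` (for `k < N`) of the configuration consisting of the triangular array `x`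
(levels `1, …, N-1`) together with the top level `a` (level `N`). -/
def lvl {N : ℕ} (a : Fin N → ℝ) (x : Tri (N - 1)) (k : ℕ) (hk : k < N) :
    Fin (k + 1) → ℝ :=
  if h : k < N - 1 then fun i => x ⟨k, h⟩ i
  else fun i => a ⟨i.1, by have := i.isLt; omega⟩

/-- The (unnormalized) density of the orbital beta process with top level `a`. -/
def obpWt (θ : ℝ) {N : ℕ} (a : Fin N → ℝ) (x : Tri (N - 1)) : ℝ :=
  ∏ k : Fin (N - 1),
    ((∏ i : Fin (k.1 + 1), ∏ j : Fin (k.1 + 1),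
        if i < j then |x k i - x k j| ^ (2 - 2 * θ) else 1) *
      ∏ s : Fin (k.1 + 2), ∏ r : Fin (k.1 + 1),
        |lvl a x (k.1 + 1) (by have := k.isLt; omega) s - x k r| ^ (θ - 1))

/-- The interlacing scheme `𝒫(a)`: arrays `(a⁽¹⁾ ≺ a⁽²⁾ ≺ ⋯ ≺ a⁽ᴺ⁻¹⁾ ≺ a)`. -/
def obpDomain {N : ℕ} (a : Fin N → ℝ) : Set (Tri (N - 1)) :=
  {x | ∀ k : Fin (N - 1),
      Interlaces (x k) (lvl a x (k.1 + 1) (by have := k.isLt; omega))}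

/-- The orbital beta process `𝕄^{a,θ}` with top level `a`. -/
def obp (θ : ℝ) {N : ℕ} (a : Fin N → ℝ) : Measure (Tri (N - 1)) :=
  (ENNReal.ofReal (∫ x in obpDomain a, obpWt θ a x))⁻¹ •
    volume.withDensity fun x =>
      ENNReal.ofReal ((obpDomain a).indicator (obpWt θ a) x)

/-- The Weyl chamber `𝒲_m = {x : x 0 ≥ x 1 ≥ ⋯}`. -/
def weylChamber (m : ℕ) : Set (Fin m → ℝ) :=
  {x | ∀ i j : Fin m, i ≤ j → x j ≤ x i}

/-- The (unnormalized) density of the Gaussian beta ensemble. -/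
def gbeWt (θ : ℝ) (m : ℕ) (x : Fin m → ℝ) : ℝ :=
  (∏ i : Fin m, ∏ j : Fin m, if i < j then |x i - x j| ^ (2 * θ) else 1) *
    Real.exp (-(θ / 2) * ∑ i, x i ^ 2)

/-- The Gaussian beta ensemble `𝕄^{(θ)}_m` of rank `m`. -/
def gbe (θ : ℝ) (m : ℕ) : Measure (Fin m → ℝ) :=
  (ENNReal.ofReal (∫ x in weylChamber m, gbeWt θ m x))⁻¹ •
    volume.withDensity fun x =>
      ENNReal.ofReal ((weylChamber m).indicator (gbeWt θ m) x)

/-- The empirical measure `μ_N = (1/N) ∑ δ_{a_i/N}`. -/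
def empMeasure {N : ℕ} (a : Fin N → ℝ) : Measure ℝ :=
  ((N : ℝ≥0∞))⁻¹ • ∑ i : Fin N, Measure.dirac (a i / N)

/-- The mean `𝔼[ν]` of a measure on `ℝ`. -/
def meanM (ν : Measure ℝ) : ℝ := ∫ t, t ∂ν

/-- The variance `Var[ν]` of a measure on `ℝ`. -/
def varM (ν : Measure ℝ) : ℝ := (∫ t, t ^ 2 ∂ν) - meanM ν ^ 2

/-- A regular sequence of ordered tuples with limiting measure `μ`. -/
def RegularSeq (a : (N : ℕ) → Fin N → ℝ) (μ : Measure ℝ) : Prop :=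
  (∀ N : ℕ, 1 ≤ N → StrictAnti (a N)) ∧
  (∃ C : ℝ, ∀ N : ℕ, ∀ hN : 1 ≤ N,
      |a N ⟨0, by omega⟩| ≤ C * N ∧ |a N ⟨N - 1, by omega⟩| ≤ C * N) ∧
  IsProbabilityMeasure μ ∧
  (∃ R : ℝ, μ {t : ℝ | |t| ≤ R}ᶜ = 0) ∧
  ∀ f : BoundedContinuousFunction ℝ ℝ,
    Tendsto (fun N : ℕ => ∫ t, f t ∂empMeasure (a N)) atTop (𝓝 (∫ t, f t ∂μ))

/-- Projection of a triangular array (with top level of size `N`) to its `m`-th level. -/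
def levelProj {N : ℕ} (m : ℕ) (h1 : 1 ≤ m) (h2 : m < N) (x : Tri (N - 1)) :
    Fin m → ℝ :=
  fun i => x ⟨m - 1, by omega⟩ ⟨i.1, (by have := i.isLt; omega : i.1 < m - 1 + 1)⟩

/-- Projection of a triangular array to its bottom `m` levels. -/
def triProj {N : ℕ} (m : ℕ) (h : m < N) (x : Tri (N - 1)) : Tri m :=
  fun k i => x ⟨k.1, by have := k.isLt; omega⟩ ⟨i.1, i.isLt⟩

/-- The top level of a triangular array with `m` levels. -/
def topLvl {m : ℕ} (hm : 1 ≤ m) (x : Tri m) : Fin m → ℝ :=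
  fun i => x ⟨m - 1, by omega⟩ ⟨i.1, (by have := i.isLt; omega : i.1 < m - 1 + 1)⟩

/-- The Gelfand–Tsetlin polytope `𝒲_{m,corners}` (weak interlacing). -/
def gtPoly (m : ℕ) : Set (Tri m) :=
  {x | ∀ k : Fin m, ∀ hk : k.1 + 1 < m, ∀ i : Fin (k.1 + 1),
      x k i ≤ x ⟨k.1 + 1, hk⟩ i.castSucc ∧ x ⟨k.1 + 1, hk⟩ i.succ ≤ x k i}

/-- Unnormalized density of the Gaussian beta corners process with `m` levels. -/
def gbcWt (θ : ℝ) {m : ℕ} (hm : 1 ≤ m) (x : Tri m) : ℝ :=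
  (∏ i : Fin m, ∏ j : Fin m,
      if i < j then topLvl hm x i - topLvl hm x j else 1) *
    Real.exp (-(θ / 2) * ∑ i, topLvl hm x i ^ 2) *
    ∏ k : Fin (m - 1),
      ((∏ i : Fin (k.1 + 1), ∏ j : Fin (k.1 + 1),
          if i < j then
            |x ⟨k.1, by have := k.isLt; omega⟩ i -
              x ⟨k.1, by have := k.isLt; omega⟩ j| ^ (2 - 2 * θ)
          else 1) *
        ∏ i : Fin (k.1 + 1), ∏ j : Fin (k.1 + 2),
          |x ⟨k.1, by have := k.isLt; omega⟩ i -
            x ⟨k.1 + 1, by have := k.isLt; omega⟩ j| ^ (θ - 1))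

/-- The Gaussian beta corners process `𝕄^{(θ)}_{m,corners}`. -/
def gbc (θ : ℝ) {m : ℕ} (hm : 1 ≤ m) : Measure (Tri m) :=
  (ENNReal.ofReal (∫ x in gtPoly m, gbcWt θ hm x))⁻¹ •
    volume.withDensity fun x =>
      ENNReal.ofReal ((gtPoly m).indicator (gbcWt θ hm) x)

/-- Strict interlacing domain `x⁽¹⁾ ≺ x⁽²⁾ ≺ ⋯ ≺ x⁽ᵐ⁾` inside `Tri m`. -/
def triDomain (m : ℕ) : Set (Tri m) :=
  {x | ∀ k : Fin m, ∀ hk : k.1 + 1 < m, Interlaces (x k) (x ⟨k.1 + 1, hk⟩)}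

/-- The θ-Gibbs conditional density of the bottom `n` levels given level `n+1`. -/
def gibbsWt (θ : ℝ) (n : ℕ) (x : Tri (n + 1)) : ℝ :=
  ((∏ k : Fin (n + 1), Real.Gamma ((k.1 + 1) * θ)) /
      Real.Gamma θ ^ ((n + 1) * (n + 2) / 2)) *
    (∏ i : Fin (n + 1), ∏ j : Fin (n + 1),
      if i < j then
        (x ⟨n, Nat.lt_succ_self n⟩ i - x ⟨n, Nat.lt_succ_self n⟩ j) ^ (1 - 2 * θ)
      else 1) *
    ∏ k : Fin n,
      ((∏ i : Fin (k.1 + 1), ∏ j : Fin (k.1 + 1),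
          if i < j then
            (x ⟨k.1, by have := k.isLt; omega⟩ i -
              x ⟨k.1, by have := k.isLt; omega⟩ j) ^ (2 - 2 * θ)
          else 1) *
        ∏ i : Fin (k.1 + 1), ∏ j : Fin (k.1 + 2),
          |x ⟨k.1, by have := k.isLt; omega⟩ i -
            x ⟨k.1 + 1, by have := k.isLt; omega⟩ j| ^ (θ - 1))

/-- `|a⁽ᵏ⁾|`, the sum of the entries of level `k` (with `a⁽⁰⁾ := 0` and `a⁽ᴺ⁾ := a`). -/
def sumLvl {N : ℕ} (a : Fin N → ℝ) (x : Tri (N - 1)) (k : ℕ) : ℝ :=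
  if k = 0 then 0
  else if h : k - 1 < N - 1 then ∑ i, x ⟨k - 1, h⟩ i
  else ∑ i, a i

/-- The multivariate Bessel function `𝓑_a(y; θ)`, defined through its combinatorial
integral representation over the interlacing scheme with top level `a`. -/
def MBF (θ : ℝ) {N : ℕ} (a : Fin N → ℝ) (y : Fin N → ℂ) : ℂ :=
  ((((∏ k : Fin N, Real.Gamma ((k.1 + 1) * θ)) /
        Real.Gamma θ ^ (N * (N + 1) / 2)) : ℝ) : ℂ) *
    (((∏ i : Fin N, ∏ j : Fin N,
        if i < j then |a i - a j| ^ (1 - 2 * θ) else 1) : ℝ) : ℂ) *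
    ∫ x in obpDomain a,
      Complex.exp (∑ k : Fin N,
        y k * ((sumLvl a x (k.1 + 1) - sumLvl a x k.1 : ℝ) : ℂ)) *
      ((obpWt θ a x : ℝ) : ℂ)

/-- Padding of an `m`-tuple with `N - m` zeros: `(y_1, …, y_m, 0^{N-m})`. -/
def padC {m N : ℕ} (_h : m ≤ N) (y : Fin m → ℂ) : Fin N → ℂ :=
  fun k => if h' : k.1 < m then y ⟨k.1, h'⟩ else 0

/-- Integrand `exp(yz) ∏ (z - a_i)^{-θ}` of the left-directed contour integral,
with `w^{-θ} := exp(-θ Log w)` for the principal branch `Log`. -/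
def contourFnL (θ : ℝ) {N : ℕ} (a : Fin N → ℝ) (y z : ℂ) : ℂ :=
  Complex.exp (y * z) *
    ∏ i : Fin N, Complex.exp (-(θ : ℂ) * Complex.log (z - (a i : ℂ)))

/-- Integrand `exp(-yz) ∏ (a_i - z)^{-θ}` of the right-directed contour integral. -/
def contourFnR (θ : ℝ) {N : ℕ} (a : Fin N → ℝ) (y z : ℂ) : ℂ :=
  Complex.exp (-y * z) *
    ∏ i : Fin N, Complex.exp (-(θ : ℂ) * Complex.log ((a i : ℂ) - z))

/-- `(y_1, …, y_m, y_{m+1})` with `y_{m+1} := y - (z_1 + ⋯ + z_m)`. -/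
def Yext {m : ℕ} (ys : Fin m → ℝ) (y : ℝ) (z : Fin m → ℝ) : Fin (m + 1) → ℝ :=
  fun j => if h : j.1 < m then ys ⟨j.1, h⟩ else y - ∑ i, z i

/-- `(z_1, …, z_m, z_{m+1})` with `z_{m+1} := 0`. -/
def Zext {m : ℕ} (z : Fin m → ℝ) : Fin (m + 1) → ℝ :=
  fun j => if h : j.1 < m then z ⟨j.1, h⟩ else 0

/-- The function `G_{θ, y_1, …, y_m, y}(z_1, …, z_m)`. -/
def Gfn (θ : ℝ) {m : ℕ} (ys : Fin m → ℝ) (y : ℝ) (z : Fin m → ℝ) : ℝ :=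
  (∏ i : Fin m, ∏ j : Fin m,
      if i < j then (ys i - ys j + z i) ^ (θ - 1) else 1) *
    ∏ i : Fin (m + 1), ∏ j : Fin (m + 1),
      if i < j then
        (Yext ys y z i - Yext ys y z j + Zext z i - Zext z j) *
          (Yext ys y z i - Yext ys y z j - Zext z j) ^ (θ - 1)
      else 1

/-- The function `F_{y_1, …, y_m, y}(z_1, …, z_m)`. -/
def Ffn {m : ℕ} (ys : Fin m → ℝ) (y : ℝ) (z : Fin m → ℝ) : ℝ :=
  (1 - (∑ i, z i) / y) * ∏ i, (1 + z i / ys i)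


/-- The absolute value of the Vandermonde product `∏_{i<j} |a i - a j|`. -/
def absVdm {n : ℕ} (a : Fin n → ℝ) : ℝ :=
  ∏ i : Fin n, ∏ j : Fin n, if i < j then |a i - a j| else 1

lemma absVdm_rpow {n : ℕ} (a : Fin n → ℝ) (s : ℝ) :
    (∏ i : Fin n, ∏ j : Fin n, if i < j then |a i - a j| ^ s else 1) = absVdm a ^ s := by
  have hnn : ∀ i j : Fin n, 0 ≤ (if i < j then |a i - a j| else 1) := by
    intro i j; split_ifs <;> positivity
  unfold absVdm
  rw [← Real.finsetProd_rpow _ _ (fun i _ => Finset.prod_nonneg fun j _ => hnn i j)]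
  refine Finset.prod_congr rfl fun i _ => ?_
  rw [← Real.finsetProd_rpow _ _ (fun j _ => hnn i j)]
  refine Finset.prod_congr rfl fun j _ => ?_
  split_ifs <;> simp

lemma absVdm_pos {n : ℕ} {a : Fin n → ℝ} (ha : Function.Injective a) : 0 < absVdm a := by
  refine Finset.prod_pos fun i _ => Finset.prod_pos fun j _ => ?_
  split_ifs with h
  · exact abs_pos.2 (sub_ne_zero.2 fun h' => h.ne (ha h'))
  · exact one_pos

lemma measurable_absVdm (n : ℕ) : Measurable fun a : Fin n → ℝ => absVdm a := by
  unfold absVdm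
  refine Finset.measurable_prod _ fun i _ => Finset.measurable_prod _ fun j _ => ?_
  split_ifs <;> fun_prop

lemma abs_det_vandermonde {n : ℕ} (a : Fin n → ℝ) :
    |(Matrix.vandermonde a).det| = absVdm a := by
  rw [Matrix.det_vandermonde, Finset.abs_prod, absVdm]
  refine Finset.prod_congr rfl fun i _ => ?_
  rw [Finset.abs_prod, ← Finset.prod_filter]
  refine Finset.prod_congr (by ext; simp) fun j _ => abs_sub_comm _ _

lemma prod_prod_erase_abs_sub {n : ℕ} (a : Fin n → ℝ) :
    ∏ i, ∏ k ∈ Finset.univ.erase i, |a i - a k| = absVdm a ^ 2 := by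
  have h1 : ∀ i, ∏ k ∈ Finset.univ.erase i, |a i - a k| =
      (∏ k, if i < k then |a i - a k| else 1) * ∏ k, if k < i then |a k - a i| else 1 := by
    intro i
    rw [← Finset.prod_mul_distrib, ← Finset.mul_prod_erase _ _ (Finset.mem_univ i)]
    simp only [lt_irrefl, if_false, one_mul]
    refine Finset.prod_congr rfl fun k hk => ?_
    rcases lt_or_gt_of_ne (Finset.ne_of_mem_erase hk) with h | h
    · simp [h, h.not_gt, abs_sub_comm]
    · simp [h, h.not_gt]
  simp_rw [h1]
  rw [Finset.prod_mul_distrib, sq]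
  congr 1
  rw [Finset.prod_comm]
  rfl

lemma prod_erase_eq_prod_succAbove {M : Type*} [CommMonoid M] {n : ℕ} (f : Fin (n + 1) → M)
    (j : Fin (n + 1)) : ∏ k ∈ Finset.univ.erase j, f k = ∏ i, f (j.succAbove i) := by
  have : Finset.univ.erase j = Finset.univ.map j.succAboveEmb := by
    ext k; simp [Fin.exists_succAbove_eq_iff]
  rw [this, Finset.prod_map]; rfl

/-- The polynomials `∂Q/∂t` and `∂Q/∂xᵢ` for `Q = t ∏ (X - xᵢ)`, where `z = (t, x)`. -/
def rootPoly {n : ℕ} (z : Fin (n + 1) → ℝ) : Fin (n + 1) → Polynomial ℝ :=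
  Fin.cons (∏ i : Fin n, (Polynomial.X - Polynomial.C (z i.succ)))
    fun i => Polynomial.C (-z 0) *
      ∏ k ∈ Finset.univ.erase i, (Polynomial.X - Polynomial.C (z k.succ))

lemma natDegree_rootPoly_lt {n : ℕ} (z : Fin (n + 1) → ℝ) (k : Fin (n + 1)) :
    (rootPoly z k).natDegree < n + 1 := by
  refine Fin.cases ?_ (fun i => ?_) k
  · simp only [rootPoly, Fin.cons_zero]
    rw [Polynomial.natDegree_prod_of_monic _ _ fun i _ => Polynomial.monic_X_sub_C _]
    simp
  · simp only [rootPoly, Fin.cons_succ]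
    refine (Polynomial.natDegree_C_mul_le _ _).trans_lt ?_
    rw [Polynomial.natDegree_prod_of_monic _ _ fun i _ => Polynomial.monic_X_sub_C _]
    simp only [Polynomial.natDegree_X_sub_C, Finset.sum_const, smul_eq_mul, mul_one]
    exact (Finset.card_le_univ _).trans_lt (by simp)

lemma det_eval_eq_vandermonde_mul {n : ℕ} (p : Fin n → Polynomial ℝ)
    (hp : ∀ k, (p k).natDegree < n) (b : Fin n → ℝ) :
    (Matrix.of fun j k => (p k).eval (b j)).det =
      (Matrix.vandermonde b).det * (Matrix.of fun l k : Fin n => (p k).coeff l).det := by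
  rw [← Matrix.det_mul]
  congr 1
  ext j k
  rw [Matrix.mul_apply, Matrix.of_apply, Polynomial.eval_eq_sum_range' (hp k),
    ← Fin.sum_univ_eq_sum_range (fun l => (p k).coeff l * b j ^ l)]
  simp [Matrix.vandermonde_apply, mul_comm]

lemma abs_det_eval_rootPoly {n : ℕ} (a z : Fin (n + 1) → ℝ) (hz : Function.Injective (Fin.tail z))
    (ht : 0 < z 0) :
    |(Matrix.of fun j k => (rootPoly z k).eval (a j)).det| =
      absVdm a * (z 0 ^ n * absVdm (Fin.tail z)) := by
  obtain ⟨y, hy⟩ : ∃ y, y ∉ Set.range (Fin.tail z) :=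
    (Set.finite_range (Fin.tail z)).exists_notMem
  set b : Fin (n + 1) → ℝ := Fin.cons y (Fin.tail z) with hb
  have hbinj : Function.Injective b := Fin.cons_injective_iff.2 ⟨hy, hz⟩
  have hpos := absVdm_pos hbinj
  have hA := congrArg abs (det_eval_eq_vandermonde_mul _ (natDegree_rootPoly_lt z) a)
  have hB := congrArg abs (det_eval_eq_vandermonde_mul _ (natDegree_rootPoly_lt z) b)
  rw [abs_mul, abs_det_vandermonde] at hA hB
  have hbv : absVdm b = (∏ i : Fin n, |y - Fin.tail z i|) * absVdm (Fin.tail z) := by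
    simp only [absVdm, hb, Fin.prod_univ_succ (n := n), Fin.cons_zero, Fin.cons_succ,
      Fin.succ_lt_succ_iff, Fin.succ_pos, Fin.not_lt_zero, if_true, if_false, one_mul]
  have htri : |(Matrix.of fun j k => (rootPoly z k).eval (b j)).det| =
      (∏ i : Fin n, |y - Fin.tail z i|) * (z 0 ^ n * absVdm (Fin.tail z) ^ 2) := by
    rw [Matrix.det_of_isUpperTriangular, Fin.prod_univ_succ, abs_mul, Finset.abs_prod]
    · congr 1
      · simp [rootPoly, hb, Polynomial.eval_prod, Finset.abs_prod, Fin.tail]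
      · simp only [rootPoly, hb, Matrix.of_apply, Fin.cons_succ, Polynomial.eval_mul,
          Polynomial.eval_prod, Polynomial.eval_sub, Polynomial.eval_X, Polynomial.eval_C,
          abs_mul, abs_neg, abs_of_pos ht, Finset.abs_prod, Finset.prod_mul_distrib]
        rw [← prod_prod_erase_abs_sub]
        simp [Fin.tail]
    · intro j k hjk
      obtain ⟨j, rfl⟩ := Fin.exists_succ_eq.2 (Fin.ne_zero_of_lt hjk)
      refine Fin.cases (fun _ => ?_) (fun k hjk => ?_) k hjk
      · simp only [rootPoly, hb, Matrix.of_apply, Fin.cons_succ, Fin.cons_zero,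
          Polynomial.eval_prod]
        exact Finset.prod_eq_zero (Finset.mem_univ j) (by simp [Fin.tail])
      · simp only [rootPoly, hb, Matrix.of_apply, Fin.cons_succ, Polynomial.eval_mul,
          Polynomial.eval_prod]
        have hne : j ≠ k := by rintro rfl; exact lt_irrefl _ hjk
        rw [Finset.prod_eq_zero (Finset.mem_erase.2 ⟨hne, Finset.mem_univ j⟩) (by simp [Fin.tail]),
          mul_zero]
  rw [htri] at hB
  rw [hA]
  congr 1
  refine mul_left_cancel₀ hpos.ne' ?_
  rw [← hB, hbv]; ring

lemma Interlaces.strictAnti {n : ℕ} {u : Fin n → ℝ} {a : Fin (n + 1) → ℝ} (h : Interlaces u a) :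
    StrictAnti u := by
  cases n with
  | zero => intro i; exact i.elim0
  | succ n =>
    rw [Fin.strictAnti_iff_succ_lt]
    intro i
    have h1 := (h i.castSucc).2
    have h2 := (h i.succ).1
    rw [Fin.succ_castSucc] at h1
    exact h2.trans h1

/-- The map `(t, x) ↦ (t ∏ᵢ (a j - x i) / ∏_{k ≠ j} (a j - a k))_j`: the residues of
`t ∏ᵢ (X - x i) / ∏ⱼ (X - a j)`. -/
def residueMap {n : ℕ} (a z : Fin (n + 1) → ℝ) : Fin (n + 1) → ℝ := fun j =>
  z 0 * (∏ i : Fin n, (a j - z i.succ)) / ∏ k ∈ Finset.univ.erase j, (a j - a k)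

/-- Pairs `(t, x)` with `t > 0` and `x ≺ a`. -/
def residueDomain {n : ℕ} (a : Fin (n + 1) → ℝ) : Set (Fin (n + 1) → ℝ) :=
  {z | 0 < z 0 ∧ Interlaces (Fin.tail z) a}

/-- The Jacobian matrix of `residueMap a` at `z`. -/
def residueJacobian {n : ℕ} (a z : Fin (n + 1) → ℝ) : Matrix (Fin (n + 1)) (Fin (n + 1)) ℝ :=
  Matrix.of fun j k => (∏ l ∈ Finset.univ.erase j, (a j - a l))⁻¹ * (rootPoly z k).eval (a j)

lemma hasFDerivAt_residueMap {n : ℕ} (a z : Fin (n + 1) → ℝ) :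
    HasFDerivAt (residueMap a) (Matrix.toLin' (residueJacobian a z)).toContinuousLinearMap z := by
  rw [hasFDerivAt_pi']
  intro j
  have h0 : HasFDerivAt (fun w : Fin (n + 1) → ℝ => w 0)
      (ContinuousLinearMap.proj (R := ℝ) (φ := fun _ : Fin (n + 1) => ℝ) 0) z :=
    hasFDerivAt_apply 0 z
  have hs : ∀ i : Fin n, HasFDerivAt (fun w : Fin (n + 1) → ℝ => a j - w i.succ)
      (-(ContinuousLinearMap.proj (R := ℝ) (φ := fun _ : Fin (n + 1) => ℝ) i.succ)) z :=
    fun i => (hasFDerivAt_apply i.succ z).const_sub (a j)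
  have hprod := HasFDerivAt.finsetProd (u := Finset.univ) fun i _ => hs i
  have := (h0.mul hprod).mul_const (∏ k ∈ Finset.univ.erase j, (a j - a k))⁻¹
  refine (this.congr_fderiv ?_)
  ext v
  simp [Matrix.mulVec, dotProduct, Fin.sum_univ_succ, residueJacobian, rootPoly,
    Polynomial.eval_prod, Finset.mul_sum]
  rw [add_comm]
  simp only [mul_assoc]

lemma abs_det_residueJacobian {n : ℕ} {a z : Fin (n + 1) → ℝ} (ha : StrictAnti a)
    (hz : z ∈ residueDomain a) :
    |(residueJacobian a z).det| = z 0 ^ n * absVdm (Fin.tail z) / absVdm a := by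
  have hpos := absVdm_pos ha.injective
  have := Matrix.det_mul_column (fun j => (∏ l ∈ Finset.univ.erase j, (a j - a l))⁻¹)
    (Matrix.of fun j k => (rootPoly z k).eval (a j))
  simp only [Matrix.of_apply] at this
  rw [residueJacobian, this, abs_mul, abs_det_eval_rootPoly a z hz.2.strictAnti.injective hz.1,
    Finset.prod_inv_distrib, abs_inv, Finset.abs_prod]
  simp_rw [Finset.abs_prod]
  rw [prod_prod_erase_abs_sub]
  field_simp

lemma StrictAnti.prod_erase_sub_ne_zero {n : ℕ} {a : Fin n → ℝ} (ha : StrictAnti a) (j : Fin n) :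
    ∏ k ∈ Finset.univ.erase j, (a j - a k) ≠ 0 :=
  Finset.prod_ne_zero_iff.2 fun _ hk =>
    sub_ne_zero.2 fun h => Finset.ne_of_mem_erase hk (ha.injective h).symm

/-- The polynomial `t ∏ (X - xᵢ)` for `z = (t, x)`. -/
def scaledRootPoly {n : ℕ} (z : Fin (n + 1) → ℝ) : Polynomial ℝ :=
  Polynomial.C (z 0) * ∏ i : Fin n, (Polynomial.X - Polynomial.C (z i.succ))

lemma eval_scaledRootPoly {n : ℕ} (z : Fin (n + 1) → ℝ) (r : ℝ) :
    (scaledRootPoly z).eval r = z 0 * ∏ i : Fin n, (r - z i.succ) := by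
  simp [scaledRootPoly, Polynomial.eval_prod]

lemma degree_scaledRootPoly_lt {n : ℕ} (z : Fin (n + 1) → ℝ) :
    (scaledRootPoly z).degree < (n + 1 : ℕ) := by
  refine Polynomial.degree_le_natDegree.trans_lt (Nat.cast_lt.2 (Nat.lt_succ_of_le ?_))
  refine (Polynomial.natDegree_C_mul_le _ _).trans ?_
  rw [Polynomial.natDegree_prod_of_monic _ _ fun i _ => Polynomial.monic_X_sub_C _]
  simp

lemma coeff_scaledRootPoly {n : ℕ} (z : Fin (n + 1) → ℝ) :
    (scaledRootPoly z).coeff n = z 0 := by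
  have hm : (∏ i : Fin n, (Polynomial.X - Polynomial.C (z i.succ))).Monic :=
    Polynomial.monic_prod_of_monic _ _ fun i _ => Polynomial.monic_X_sub_C _
  have hd : (∏ i : Fin n, (Polynomial.X - Polynomial.C (z i.succ))).natDegree = n := by
    rw [Polynomial.natDegree_prod_of_monic _ _ fun i _ => Polynomial.monic_X_sub_C _]; simp
  have : (∏ i : Fin n, (Polynomial.X - Polynomial.C (z i.succ))).coeff n = 1 := by
    have := hm.coeff_natDegree
    rwa [hd] at this
  rw [scaledRootPoly, Polynomial.coeff_C_mul, this, mul_one]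

lemma sum_residueMap {n : ℕ} {a : Fin (n + 1) → ℝ} (ha : StrictAnti a) (z : Fin (n + 1) → ℝ) :
    ∑ j, residueMap a z j = z 0 := by
  have := Lagrange.coeff_eq_sum (s := Finset.univ) (v := a) ha.injective.injOn
    (P := scaledRootPoly z) (by simpa using degree_scaledRootPoly_lt z)
  simp only [Finset.card_univ, Fintype.card_fin, Nat.add_sub_cancel, coeff_scaledRootPoly,
    eval_scaledRootPoly] at this
  exact this.symm

lemma residueMap_eq_prod {n : ℕ} (a z : Fin (n + 1) → ℝ) (j : Fin (n + 1)) :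
    residueMap a z j = z 0 * ∏ i : Fin n, (a j - z i.succ) / (a j - a (j.succAbove i)) := by
  rw [residueMap, prod_erase_eq_prod_succAbove (fun k => a j - a k), mul_div_assoc,
    Finset.prod_div_distrib]

lemma Interlaces.div_pos {n : ℕ} {u : Fin n → ℝ} {a : Fin (n + 1) → ℝ} (h : Interlaces u a)
    (ha : StrictAnti a) (j : Fin (n + 1)) (i : Fin n) :
    0 < (a j - u i) / (a j - a (j.succAbove i)) := by
  rcases lt_or_ge i.castSucc j with hij | hij
  · have h1 : a j ≤ a i.succ := ha.antitone (Fin.castSucc_lt_iff_succ_le.1 hij)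
    have h2 := h i
    rw [Fin.succAbove_of_castSucc_lt _ _ hij]
    exact div_pos_of_neg_of_neg (by linarith) (by linarith)
  · have h1 : a i.castSucc ≤ a j := ha.antitone hij
    have h2 := h i
    rw [Fin.succAbove_of_le_castSucc _ _ hij]
    exact _root_.div_pos (by linarith) (by linarith)

lemma injOn_residueMap {n : ℕ} {a : Fin (n + 1) → ℝ} (ha : StrictAnti a) :
    Set.InjOn (residueMap a) (residueDomain a) := by
  intro z hz w hw hzw
  have hpoly : scaledRootPoly z = scaledRootPoly w := by
    refine Polynomial.eq_of_degrees_lt_of_eval_index_eq Finset.univ (v := a) ha.injective.injOn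
      (by simpa using degree_scaledRootPoly_lt z) (by simpa using degree_scaledRootPoly_lt w)
      fun j _ => ?_
    have := congrFun hzw j
    simp only [residueMap] at this
    rw [div_left_inj' (StrictAnti.prod_erase_sub_ne_zero ha j)] at this
    simpa [eval_scaledRootPoly] using this
  have h0 : z 0 = w 0 := by rw [← sum_residueMap ha z, hzw, sum_residueMap ha w]
  funext k
  refine Fin.cases h0 (fun i => ?_) k
  have hev := congrArg (Polynomial.eval (z i.succ)) hpoly
  rw [eval_scaledRootPoly, eval_scaledRootPoly, Finset.prod_eq_zero (Finset.mem_univ i)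
    (sub_self _), mul_zero, eq_comm, mul_eq_zero, or_iff_right hw.1.ne', Finset.prod_eq_zero_iff]
    at hev
  obtain ⟨l, -, hl⟩ := hev
  have hl : z i.succ = w l.succ := by linarith
  have hzi := hz.2 i
  have hwl := hw.2 l
  simp only [Fin.tail] at hzi hwl
  suffices i = l by rw [hl, this]
  by_contra hne
  rcases lt_or_gt_of_ne hne with h | h
  · have : a l.castSucc ≤ a i.succ := ha.antitone (by
      rw [Fin.le_def]; simpa using h)
    linarith
  · have : a i.castSucc ≤ a l.succ := ha.antitone (by
      rw [Fin.le_def]; simpa using h)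
    linarith

lemma residueMap_pos {n : ℕ} {a z : Fin (n + 1) → ℝ} (ha : StrictAnti a)
    (hz : z ∈ residueDomain a) (j : Fin (n + 1)) : 0 < residueMap a z j := by
  rw [residueMap_eq_prod]
  exact mul_pos hz.1 (Finset.prod_pos fun i _ => hz.2.div_pos ha j i)

lemma exists_root_of_mul_neg (p : Polynomial ℝ) {s t : ℝ} (hst : s < t)
    (h : p.eval s * p.eval t < 0) : ∃ r, s < r ∧ r < t ∧ p.eval r = 0 := by
  have hc : ContinuousOn (fun r => p.eval r) (Set.Icc s t) := p.continuous.continuousOn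
  rcases mul_neg_iff.1 h with ⟨h1, h2⟩ | ⟨h1, h2⟩
  · obtain ⟨r, hr, hr'⟩ := intermediate_value_Ioo' hst.le hc ⟨h2, h1⟩
    exact ⟨r, hr.1, hr.2, hr'⟩
  · obtain ⟨r, hr, hr'⟩ := intermediate_value_Ioo hst.le hc ⟨h1, h2⟩
    exact ⟨r, hr.1, hr.2, hr'⟩

lemma prod_erase_mul_prod_erase_neg {n : ℕ} {a : Fin (n + 1) → ℝ} (ha : StrictAnti a)
    (i : Fin n) :
    (∏ k ∈ Finset.univ.erase i.succ, (a i.succ - a k)) *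
      (∏ k ∈ Finset.univ.erase i.castSucc, (a i.castSucc - a k)) < 0 := by
  rw [prod_erase_eq_prod_succAbove (fun k => a i.succ - a k),
    prod_erase_eq_prod_succAbove (fun k => a i.castSucc - a k), ← Finset.prod_mul_distrib,
    ← Finset.mul_prod_erase _ _ (Finset.mem_univ i)]
  have hi := ha i.castSucc_lt_succ
  refine mul_neg_of_neg_of_pos ?_ (Finset.prod_pos fun l hl => ?_)
  · rw [Fin.succAbove_of_castSucc_lt _ _ i.castSucc_lt_succ,
      Fin.succAbove_of_le_castSucc _ _ le_rfl]
    nlinarith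
  · have hil : i.castSucc < i.succ := i.castSucc_lt_succ
    rcases lt_or_gt_of_ne (Finset.ne_of_mem_erase hl) with h | h
    · rw [Fin.succAbove_of_castSucc_lt _ _ ((Fin.castSucc_lt_castSucc_iff.2 h).trans hil),
        Fin.succAbove_of_castSucc_lt _ _ (by simpa using h)]
      have := ha (Fin.castSucc_lt_castSucc_iff.2 h)
      nlinarith
    · rw [Fin.succAbove_of_le_castSucc _ _ (by rw [Fin.le_def]; simpa using h),
        Fin.succAbove_of_le_castSucc _ _ (by simpa using h.le)]
      have := ha (Fin.succ_lt_succ_iff.2 h)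
      nlinarith

lemma image_residueMap {n : ℕ} {a : Fin (n + 1) → ℝ} (ha : StrictAnti a) :
    Set.image (residueMap a) (residueDomain a) = Set.univ.pi fun _ => Set.Ioi 0 := by
  refine Set.Subset.antisymm ?_ fun u hu => ?_
  · rintro _ ⟨z, hz, rfl⟩ j -
    exact residueMap_pos ha hz j
  have hu : ∀ j, 0 < u j := fun j => hu j trivial
  set d : Fin (n + 1) → ℝ := fun j => ∏ k ∈ Finset.univ.erase j, (a j - a k) with hd
  have hd0 : ∀ j, d j ≠ 0 := StrictAnti.prod_erase_sub_ne_zero ha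
  set Q := Lagrange.interpolate Finset.univ a (fun j => u j * d j) with hQ
  have hQev : ∀ j, Q.eval (a j) = u j * d j := fun j =>
    Lagrange.eval_interpolate_at_node _ ha.injective.injOn (Finset.mem_univ j)
  have hQdeg : Q.degree < (n + 1 : ℕ) := by
    have := Lagrange.degree_interpolate_lt (s := Finset.univ) (v := a) (fun j => u j * d j)
      ha.injective.injOn
    rwa [Finset.card_univ, Fintype.card_fin] at this
  have hQcoeff : Q.coeff n = ∑ j, u j := by
    have := Lagrange.coeff_eq_sum (s := Finset.univ) (v := a) ha.injective.injOn
      (P := Q) (by simpa using hQdeg)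
    simp only [Finset.card_univ, Fintype.card_fin, Nat.add_sub_cancel, hQev] at this
    rw [this]
    exact Finset.sum_congr rfl fun j _ => mul_div_cancel_right₀ _ (hd0 j)
  have hroot : ∀ i : Fin n, ∃ r, a i.succ < r ∧ r < a i.castSucc ∧ Q.eval r = 0 := fun i => by
    refine exists_root_of_mul_neg Q (ha i.castSucc_lt_succ) ?_
    rw [hQev, hQev, mul_mul_mul_comm]
    exact mul_neg_of_pos_of_neg (mul_pos (hu _) (hu _)) (prod_erase_mul_prod_erase_neg ha i)
  choose x hx1 hx2 hx3 using hroot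
  have hx : Interlaces x a := fun i => ⟨hx2 i, hx1 i⟩
  set z : Fin (n + 1) → ℝ := Fin.cons (∑ j, u j) x with hz
  have hpoly : Q = scaledRootPoly z := by
    refine Polynomial.eq_of_degree_sub_lt_of_eval_index_eq Finset.univ (v := x)
      hx.strictAnti.injective.injOn ?_ fun i _ => ?_
    · rw [Finset.card_univ, Fintype.card_fin, Polynomial.degree_lt_iff_coeff_zero]
      intro m hm
      rw [Polynomial.coeff_sub]
      rcases hm.eq_or_lt with rfl | hm
      · rw [hQcoeff, coeff_scaledRootPoly]; simp [hz]
      · rw [(Polynomial.degree_lt_iff_coeff_zero _ _).1 hQdeg m hm,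
          (Polynomial.degree_lt_iff_coeff_zero _ _).1 (degree_scaledRootPoly_lt z) m hm, sub_zero]
    · rw [hx3, eval_scaledRootPoly, Finset.prod_eq_zero (Finset.mem_univ i) (by simp [hz]),
        mul_zero]
  refine ⟨z, ⟨?_, ?_⟩, ?_⟩
  · simpa [hz] using Finset.sum_pos (fun j _ => hu j) Finset.univ_nonempty
  · simpa [hz] using hx
  · funext j
    rw [residueMap, div_eq_iff (hd0 j), ← eval_scaledRootPoly, ← hpoly, hQev]

lemma lintegral_Ioi_gamma {s : ℝ} (hs : 0 < s) :
    ∫⁻ t in Set.Ioi (0 : ℝ), ENNReal.ofReal (Real.exp (-t) * t ^ (s - 1)) =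
      ENNReal.ofReal (Real.Gamma s) := by
  rw [Real.Gamma_eq_integral hs, ofReal_integral_eq_lintegral_ofReal
    (Real.GammaIntegral_convergent hs)]
  filter_upwards [self_mem_ae_restrict measurableSet_Ioi] with t ht
  have : 0 < t := ht
  positivity

lemma lintegral_orthant_gamma {s : ℝ} (hs : 0 < s) (n : ℕ) :
    ∫⁻ u in (Set.univ.pi fun _ : Fin n => Set.Ioi (0 : ℝ)),
      ENNReal.ofReal (∏ j, (Real.exp (-u j) * u j ^ (s - 1))) =
      ENNReal.ofReal (Real.Gamma s ^ n) := by
  rw [volume_pi, Measure.restrict_pi_pi, Real.Gamma_eq_integral hs, ← Fintype.card_fin n,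
    ← integral_fintype_prod_eq_pow, Fintype.card_fin, ofReal_integral_eq_lintegral_ofReal]
  · exact Integrable.fintype_prod fun _ => Real.GammaIntegral_convergent hs
  · rw [← Measure.restrict_pi_pi]
    filter_upwards [self_mem_ae_restrict (MeasurableSet.univ_pi fun _ => measurableSet_Ioi)]
      with u hu
    refine Finset.prod_nonneg fun j _ => ?_
    have : 0 < u j := hu j trivial
    positivity

lemma measurableSet_interlaces {n : ℕ} (a : Fin (n + 1) → ℝ) :
    MeasurableSet {x : Fin n → ℝ | Interlaces x a} := by
  simp only [Interlaces, Set.ofPred_forall]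
  refine MeasurableSet.iInter fun i => ?_
  exact (measurableSet_lt (measurable_pi_apply i) measurable_const).inter
    (measurableSet_lt measurable_const (measurable_pi_apply i))

lemma residueDomain_eq {n : ℕ} (a : Fin (n + 1) → ℝ) :
    residueDomain a = MeasurableEquiv.piFinSuccAbove (fun _ : Fin (n + 1) => ℝ) 0 ⁻¹'
      (Set.Ioi 0 ×ˢ {x | Interlaces x a}) := rfl

lemma prod_residueMap_rpow {n : ℕ} {a z : Fin (n + 1) → ℝ} (ha : StrictAnti a)
    (hz : z ∈ residueDomain a) (θ : ℝ) :
    ∏ j, residueMap a z j ^ (θ - 1) =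
      z 0 ^ ((n + 1) * (θ - 1)) *
        (∏ s : Fin (n + 1), ∏ r : Fin n, |a s - Fin.tail z r| ^ (θ - 1)) *
        absVdm a ^ (-2 * (θ - 1)) := by
  have hpos := absVdm_pos ha.injective
  have h1 : ∀ j, residueMap a z j ^ (θ - 1) =
      z 0 ^ (θ - 1) * (∏ r : Fin n, |a j - Fin.tail z r| ^ (θ - 1)) *
        (∏ k ∈ Finset.univ.erase j, |a j - a k|) ^ (-(θ - 1)) := by
    intro j
    rw [← abs_of_pos (residueMap_pos ha hz j), residueMap, abs_div, abs_mul, abs_of_pos hz.1,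
      Finset.abs_prod, Finset.abs_prod,
      Real.div_rpow (mul_nonneg hz.1.le (Finset.prod_nonneg fun _ _ => abs_nonneg _))
        (Finset.prod_nonneg fun _ _ => abs_nonneg _),
      Real.mul_rpow hz.1.le (Finset.prod_nonneg fun _ _ => abs_nonneg _),
      Real.finsetProd_rpow _ _ (fun _ _ => abs_nonneg _),
      Real.rpow_neg (Finset.prod_nonneg fun _ _ => abs_nonneg _)]
    rfl
  simp_rw [h1]
  rw [Finset.prod_mul_distrib, Finset.prod_mul_distrib,
    Real.finsetProd_rpow _ (fun j => ∏ k ∈ Finset.univ.erase j, |a j - a k|)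
      (fun _ _ => Finset.prod_nonneg fun _ _ => abs_nonneg _), prod_prod_erase_abs_sub]
  congr 1
  · congr 1
    rw [Finset.prod_const, Finset.card_univ, Fintype.card_fin, ← Real.rpow_natCast,
      ← Real.rpow_mul hz.1.le]
    push_cast; ring_nf
  · rw [← Real.rpow_natCast, ← Real.rpow_mul hpos.le]
    push_cast; ring_nf

/-- The integrand of the Dixon–Anderson integral with equal parameters. -/
def dixonWt (θ : ℝ) {n : ℕ} (a : Fin (n + 1) → ℝ) (x : Fin n → ℝ) : ℝ :=
  absVdm x * ∏ s : Fin (n + 1), ∏ r : Fin n, |a s - x r| ^ (θ - 1)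

lemma measurable_dixonWt (θ : ℝ) {n : ℕ} (a : Fin (n + 1) → ℝ) :
    Measurable (dixonWt θ a) := by
  have := measurable_absVdm n
  unfold dixonWt
  fun_prop

/-- The Dixon–Anderson integral with equal parameters. -/
lemma lintegral_dixonWt {θ : ℝ} (hθ : 0 < θ) {n : ℕ} {a : Fin (n + 1) → ℝ} (ha : StrictAnti a) :
    ∫⁻ x in {x | Interlaces x a}, ENNReal.ofReal (dixonWt θ a x) =
      ENNReal.ofReal (Real.Gamma θ ^ (n + 1) / Real.Gamma ((n + 1) * θ) *
        absVdm a ^ (2 * θ - 1)) := by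
  have hpos := absVdm_pos ha.injective
  have hn : (0 : ℝ) < (n + 1) * θ := by positivity
  have hΓ := Real.Gamma_pos_of_pos hn
  have hmeas : MeasurableSet (residueDomain a) := by
    rw [residueDomain_eq]
    exact (MeasurableEquiv.measurable _)
      (measurableSet_Ioi.prod (measurableSet_interlaces a))
  have key := lintegral_image_eq_lintegral_abs_det_fderiv_mul volume hmeas
    (fun z _ => (hasFDerivAt_residueMap a z).hasFDerivWithinAt) (injOn_residueMap ha)
    (fun u => ENNReal.ofReal (∏ j, (Real.exp (-u j) * u j ^ (θ - 1))))
  rw [image_residueMap ha, lintegral_orthant_gamma hθ] at key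
  have hcongr : ∀ z ∈ residueDomain a,
      ENNReal.ofReal |(Matrix.toLin' (residueJacobian a z)).toContinuousLinearMap.det| *
        ENNReal.ofReal (∏ j, (Real.exp (-residueMap a z j) * residueMap a z j ^ (θ - 1))) =
      ENNReal.ofReal (absVdm a ^ (1 - 2 * θ)) *
        (ENNReal.ofReal (Real.exp (-z 0) * z 0 ^ ((n + 1) * θ - 1)) *
        ENNReal.ofReal (dixonWt θ a (Fin.tail z))) := by
    intro z hz
    have hz0 := hz.1
    have hx := absVdm_pos hz.2.strictAnti.injective
    rw [LinearMap.det_toContinuousLinearMap, LinearMap.det_toLin', abs_det_residueJacobian ha hz,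
      Finset.prod_mul_distrib, prod_residueMap_rpow ha hz, ← Real.exp_sum,
      Finset.sum_neg_distrib, sum_residueMap ha,
      ← ENNReal.ofReal_mul (by positivity),
      ← ENNReal.ofReal_mul (p := Real.exp (-z 0) * z 0 ^ ((n + 1) * θ - 1)) (by positivity),
      ← ENNReal.ofReal_mul (by positivity)]
    congr 1
    have e1 : z 0 ^ ((n + 1) * θ - 1) = z 0 ^ n * z 0 ^ ((n + 1) * (θ - 1)) := by
      rw [← Real.rpow_natCast, ← Real.rpow_add hz0]; ring_nf
    have e2 : absVdm a ^ (1 - 2 * θ) = absVdm a ^ (-2 * (θ - 1)) / absVdm a := by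
      rw [← Real.rpow_sub_one hpos.ne']; ring_nf
    rw [e1, e2, dixonWt]
    ring
  rw [setLIntegral_congr_fun hmeas hcongr, residueDomain_eq,
    lintegral_const_mul' _ _ ENNReal.ofReal_ne_top] at key
  have hsplit := (volume_preserving_piFinSuccAbove
    (fun _ : Fin (n + 1) => ℝ) 0).setLIntegral_comp_preimage_emb
    (MeasurableEquiv.measurableEmbedding _)
    (fun q : ℝ × (Fin n → ℝ) => ENNReal.ofReal (Real.exp (-q.1) * q.1 ^ ((n + 1) * θ - 1)) *
        ENNReal.ofReal (dixonWt θ a q.2)) (Set.Ioi 0 ×ˢ {x | Interlaces x a})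
  erw [hsplit] at key
  rw [Measure.volume_eq_prod, ← Measure.prod_restrict, lintegral_prod_mul
    (f := fun t : ℝ => ENNReal.ofReal (Real.exp (-t) * t ^ ((n + 1) * θ - 1)))
    (by fun_prop) (measurable_dixonWt θ a).ennreal_ofReal.aemeasurable,
    lintegral_Ioi_gamma hn] at key
  have hne : ENNReal.ofReal (absVdm a ^ (1 - 2 * θ) * Real.Gamma ((n + 1) * θ)) ≠ 0 :=
    (ENNReal.ofReal_pos.2 (by positivity)).ne'
  have hinv : absVdm a ^ (1 - 2 * θ) * absVdm a ^ (2 * θ - 1) = 1 := by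
    rw [← Real.rpow_add hpos]; norm_num
  refine (ENNReal.mul_right_inj hne ENNReal.ofReal_ne_top).1 ?_
  rw [ENNReal.ofReal_mul (by positivity), mul_assoc, ← key, ← ENNReal.ofReal_mul (by positivity),
    ← ENNReal.ofReal_mul (by positivity)]
  congr 1
  have : ∀ v w g h : ℝ, h ≠ 0 → v * w = 1 → v * h * (g / h * w) = g := by
    intro v w g h hh hvw
    field_simp
    linear_combination g * hvw
  exact (this _ _ _ _ hΓ.ne' hinv).symm

/-- The levels above the `p`-th one of a triangular array with `M` levels. -/
abbrev UpTri (p M : ℕ) := ∀ k : {k : Fin M // ¬ k.1 < p}, Fin (k.1.1 + 1) → ℝ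

/-- The identification of `Fin p` with the elements of `Fin M` below `p`. -/
def finLtEquiv {p M : ℕ} (h : p ≤ M) : Fin p ≃ {k : Fin M // k.1 < p} where
  toFun k := ⟨⟨k.1, k.2.trans_le h⟩, k.2⟩
  invFun k := ⟨k.1.1, k.2⟩
  left_inv _ := rfl
  right_inv _ := rfl

/-- Gluing the lowest `p` levels and the remaining levels to a triangular array. -/
def joinTri {p M : ℕ} (h : p ≤ M) : (Tri p × UpTri p M) ≃ᵐ Tri M :=
  (MeasurableEquiv.prodCongr
    (MeasurableEquiv.piCongrLeft (fun k : {k : Fin M // k.1 < p} => Fin (k.1.1 + 1) → ℝ)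
      (finLtEquiv h)) (MeasurableEquiv.refl _)).trans
  (MeasurableEquiv.piEquivPiSubtypeProd (fun k : Fin M => Fin (k.1 + 1) → ℝ)
    (fun k => k.1 < p)).symm

lemma measurePreserving_joinTri {p M : ℕ} (h : p ≤ M) : MeasurePreserving (joinTri h) := by
  have h1 := (volume_measurePreserving_piCongrLeft
    (fun k : {k : Fin M // k.1 < p} => Fin (k.1.1 + 1) → ℝ) (finLtEquiv h)).prod
    (MeasurePreserving.id (volume : Measure (UpTri p M)))
  have h2 := (volume_preserving_piEquivPiSubtypeProd (fun k : Fin M => Fin (k.1 + 1) → ℝ)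
    (fun k => k.1 < p)).symm
  exact h2.comp h1

lemma joinTri_of_lt {p M : ℕ} (h : p ≤ M) (l : Tri p) (w : UpTri p M) (k : ℕ) (hk : k < p) :
    joinTri h (l, w) ⟨k, hk.trans_le h⟩ = l ⟨k, hk⟩ := by
  have : joinTri h (l, w) ⟨k, hk.trans_le h⟩ =
      MeasurableEquiv.piCongrLeft (fun k : {k : Fin M // k.1 < p} => Fin (k.1.1 + 1) → ℝ)
      (finLtEquiv h) l (finLtEquiv h ⟨k, hk⟩) :=
    dif_pos hk
  rw [this]
  exact Equiv.piCongrLeft_apply_apply _ _ _ _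

lemma joinTri_of_not_lt {p M : ℕ} (h : p ≤ M) (l : Tri p) (w : UpTri p M) (k : Fin M)
    (hk : ¬ k.1 < p) : joinTri h (l, w) k = w ⟨k, hk⟩ :=
  dif_neg hk

/-- The lowest level of an upper array. -/
def UpTri.bot {p M : ℕ} (hp : p < M) (w : UpTri p M) : Fin (p + 1) → ℝ :=
  w ⟨⟨p, hp⟩, lt_irrefl p⟩

lemma lvl_joinTri_of_le {p M : ℕ} (hp : p < M) (a : Fin (M + 1) → ℝ) (l : Tri p)
    (w : UpTri p M) (k : ℕ) (hk : k ≤ p) :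
    lvl a (joinTri hp.le (l, w)) k (by omega) =
      lvl (w.bot hp) l k (Nat.lt_succ_of_le hk) := by
  rcases hk.lt_or_eq with hk | rfl
  · have h1 : k < M + 1 - 1 := by omega
    have h2 : k < p + 1 - 1 := by omega
    simp only [lvl, h1, h2, dif_pos]
    exact joinTri_of_lt hp.le l w k hk
  · have h1 : k < M + 1 - 1 := by omega
    have h2 : ¬ k < k + 1 - 1 := by omega
    simp only [lvl, h1, h2, dif_pos, dif_neg, not_false_eq_true]
    exact joinTri_of_not_lt hp.le l w ⟨k, hp⟩ (lt_irrefl k)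

lemma lvl_joinTri_of_ge {p M : ℕ} (hp : p ≤ M) (a : Fin (M + 1) → ℝ) (l l' : Tri p)
    (w : UpTri p M) (k : ℕ) (hk : p ≤ k) (hkM : k < M + 1) :
    lvl a (joinTri hp (l, w)) k hkM = lvl a (joinTri hp (l', w)) k hkM := by
  by_cases h1 : k < M + 1 - 1
  · simp only [lvl, h1, dif_pos]
    exact (joinTri_of_not_lt hp l w ⟨k, h1⟩ hk.not_gt).trans
      (joinTri_of_not_lt hp l' w ⟨k, h1⟩ hk.not_gt).symm
  · simp only [lvl, h1, dif_neg, not_false_eq_true]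

/-- The factor of the density of the orbital beta process coming from two adjacent levels. -/
def adjWt (θ : ℝ) {k : ℕ} (u : Fin (k + 1) → ℝ) (b : Fin (k + 2) → ℝ) : ℝ :=
  (∏ i : Fin (k + 1), ∏ j : Fin (k + 1), if i < j then |u i - u j| ^ (2 - 2 * θ) else 1) *
    ∏ s : Fin (k + 2), ∏ r : Fin (k + 1), |b s - u r| ^ (θ - 1)

lemma adjWt_nonneg (θ : ℝ) {k : ℕ} (u : Fin (k + 1) → ℝ) (b : Fin (k + 2) → ℝ) :
    0 ≤ adjWt θ u b := by
  refine mul_nonneg (Finset.prod_nonneg fun i _ => Finset.prod_nonneg fun j _ => ?_) (by positivity)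
  split_ifs <;> positivity

/-- The density of the orbital beta process restricted to the interlacing scheme. -/
def obpDens (θ : ℝ) {N : ℕ} (a : Fin N → ℝ) : Tri (N - 1) → ℝ :=
  (obpDomain a).indicator (obpWt θ a)

/-- The upper arrays interlacing with the top level `a`. -/
def upDomain {M : ℕ} (p : ℕ) (hp : p ≤ M) (a : Fin (M + 1) → ℝ) : Set (UpTri p M) :=
  {w | ∀ k : {k : Fin M // ¬ k.1 < p},
    Interlaces (w k) (lvl a (joinTri hp (0, w)) (k.1.1 + 1) (Nat.succ_lt_succ k.1.2))}

/-- The factor of `obpDens` which depends on the upper levels only. -/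
def upDens (θ : ℝ) {M : ℕ} (p : ℕ) (hp : p ≤ M) (a : Fin (M + 1) → ℝ) : UpTri p M → ℝ :=
  (upDomain p hp a).indicator fun w => ∏ k : {k : Fin M // ¬ k.1 < p},
    adjWt θ (w k) (lvl a (joinTri hp (0, w)) (k.1.1 + 1) (Nat.succ_lt_succ k.1.2))

lemma obpWt_nonneg (θ : ℝ) {N : ℕ} (a : Fin N → ℝ) (x : Tri (N - 1)) : 0 ≤ obpWt θ a x :=
  Finset.prod_nonneg fun _ _ => adjWt_nonneg θ _ _

lemma obpDens_nonneg (θ : ℝ) {N : ℕ} (a : Fin N → ℝ) (x : Tri (N - 1)) : 0 ≤ obpDens θ a x :=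
  Set.indicator_nonneg (fun _ _ => obpWt_nonneg θ a _) x

lemma upDens_nonneg (θ : ℝ) {M : ℕ} (p : ℕ) (hp : p ≤ M) (a : Fin (M + 1) → ℝ)
    (w : UpTri p M) : 0 ≤ upDens θ p hp a w :=
  Set.indicator_nonneg (fun _ _ => Finset.prod_nonneg fun _ _ => adjWt_nonneg θ _ _) w

lemma joinTri_mem_obpDomain {p M : ℕ} (hp : p < M) (a : Fin (M + 1) → ℝ) (l : Tri p)
    (w : UpTri p M) :
    joinTri hp.le (l, w) ∈ obpDomain a ↔ l ∈ obpDomain (w.bot hp) ∧ w ∈ upDomain p hp.le a := by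
  constructor
  · intro h
    refine ⟨fun k => ?_, fun k => ?_⟩
    · have := h ⟨k.1, (k.2 : k.1 < p).trans hp⟩
      rw [lvl_joinTri_of_le hp a l w (k.1 + 1) k.2] at this
      rwa [joinTri_of_lt hp.le l w k.1 k.2] at this
    · have := h k.1
      rw [lvl_joinTri_of_ge hp.le a l 0 w (k.1.1 + 1) (by have := k.2; omega)] at this
      rwa [joinTri_of_not_lt hp.le l w k.1 k.2] at this
  · rintro ⟨h1, h2⟩ k
    by_cases hk : k.1 < p
    · have := h1 ⟨k.1, hk⟩
      rw [lvl_joinTri_of_le hp a l w (k.1 + 1) hk]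
      rwa [← joinTri_of_lt hp.le l w k.1 hk] at this
    · have := h2 ⟨k, hk⟩
      rw [lvl_joinTri_of_ge hp.le a l 0 w (k.1 + 1) (by omega)]
      rwa [← joinTri_of_not_lt hp.le l w k hk] at this

lemma obpWt_joinTri (θ : ℝ) {p M : ℕ} (hp : p < M) (a : Fin (M + 1) → ℝ) (l : Tri p)
    (w : UpTri p M) :
    obpWt θ a (joinTri hp.le (l, w)) = obpWt θ (w.bot hp) l *
      ∏ k : {k : Fin M // ¬ k.1 < p},
        adjWt θ (w k) (lvl a (joinTri hp.le (0, w)) (k.1.1 + 1) (Nat.succ_lt_succ k.1.2)) := by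
  have h := Fintype.prod_subtype_mul_prod_subtype (fun k : Fin M => k.1 < p) fun k =>
    adjWt θ (joinTri hp.le (l, w) k)
      (lvl a (joinTri hp.le (l, w)) (k.1 + 1) (Nat.succ_lt_succ k.2))
  refine h.symm.trans (congrArg₂ _ ?_ (Finset.prod_congr rfl fun k _ => ?_))
  · rw [← (finLtEquiv hp.le).prod_comp]
    refine Finset.prod_congr rfl fun k _ => ?_
    have h1 := joinTri_of_lt hp.le l w k.1 k.2
    have h2 := lvl_joinTri_of_le hp a l w (k.1 + 1) k.2
    exact congrArg₂ (adjWt θ) h1 h2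
  · rw [joinTri_of_not_lt hp.le l w k.1 k.2,
      lvl_joinTri_of_ge hp.le a l 0 w (k.1.1 + 1) (by have := k.2; omega)]

lemma obpDens_joinTri (θ : ℝ) {p M : ℕ} (hp : p < M) (a : Fin (M + 1) → ℝ) (l : Tri p)
    (w : UpTri p M) :
    obpDens θ a (joinTri hp.le (l, w)) = obpDens θ (w.bot hp) l * upDens θ p hp.le a w := by
  unfold obpDens upDens
  have h := joinTri_mem_obpDomain hp a l w
  by_cases h1 : l ∈ obpDomain (w.bot hp)
  · by_cases h2 : w ∈ upDomain p hp.le a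
    · rw [Set.indicator_of_mem (h.2 ⟨h1, h2⟩), Set.indicator_of_mem h1, Set.indicator_of_mem h2,
        obpWt_joinTri]
    · rw [Set.indicator_of_notMem fun hh => h2 (h.1 hh).2, Set.indicator_of_notMem h2, mul_zero]
  · rw [Set.indicator_of_notMem fun hh => h1 (h.1 hh).1, Set.indicator_of_notMem h1, zero_mul]

lemma measurable_lvl {N : ℕ} (k : ℕ) (hk : k < N) (i : Fin (k + 1)) :
    Measurable fun q : (Fin N → ℝ) × Tri (N - 1) => lvl q.1 q.2 k hk i := by
  unfold lvl
  split_ifs <;> fun_prop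

lemma measurableSet_mem_obpDomain (N : ℕ) :
    MeasurableSet {q : (Fin N → ℝ) × Tri (N - 1) | q.2 ∈ obpDomain q.1} := by
  have : {q : (Fin N → ℝ) × Tri (N - 1) | q.2 ∈ obpDomain q.1} =
      ⋂ (k : Fin (N - 1)) (i : Fin (k.1 + 1)),
        {q : (Fin N → ℝ) × Tri (N - 1) |
          q.2 k i < lvl q.1 q.2 (k.1 + 1) (by have := k.isLt; omega) i.castSucc ∧
          lvl q.1 q.2 (k.1 + 1) (by have := k.isLt; omega) i.succ < q.2 k i} := by
    ext q; simp [obpDomain, Interlaces]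
  rw [this]
  refine MeasurableSet.iInter fun k => MeasurableSet.iInter fun i => ?_
  exact (measurableSet_lt (by fun_prop) (measurable_lvl _ _ _)).inter
    (measurableSet_lt (measurable_lvl _ _ _) (by fun_prop))

lemma measurable_obpDens (θ : ℝ) (N : ℕ) :
    Measurable fun q : (Fin N → ℝ) × Tri (N - 1) => obpDens θ q.1 q.2 := by
  have h : Measurable fun q : (Fin N → ℝ) × Tri (N - 1) => obpWt θ q.1 q.2 := by
    unfold obpWt
    refine Finset.measurable_prod _ fun k _ => Measurable.mul ?_ ?_
    · refine Finset.measurable_prod _ fun i _ => Finset.measurable_prod _ fun j _ => ?_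
      split_ifs <;> fun_prop
    · refine Finset.measurable_prod _ fun i _ => Finset.measurable_prod _ fun j _ => ?_
      have := measurable_lvl (k.1 + 1) (by have := k.isLt; omega : k.1 + 1 < N) i
      fun_prop
  exact h.indicator (measurableSet_mem_obpDomain N)

lemma measurable_obpDens_right (θ : ℝ) {N : ℕ} (a : Fin N → ℝ) : Measurable (obpDens θ a) :=
  (measurable_obpDens θ N).comp measurable_prodMk_left

lemma lintegral_obpDens_eq (θ : ℝ) {p M : ℕ} (hp : p < M) (a : Fin (M + 1) → ℝ) :
    ∫⁻ x, ENNReal.ofReal (obpDens θ a x) =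
      ∫⁻ w, ENNReal.ofReal (upDens θ p hp.le a w) *
        ∫⁻ l, ENNReal.ofReal (obpDens θ (w.bot hp) l) := by
  have hm : Measurable fun x => ENNReal.ofReal (obpDens θ a x) :=
    (measurable_obpDens_right θ a).ennreal_ofReal
  refine ((measurePreserving_joinTri hp.le).lintegral_comp hm).symm.trans ?_
  rw [Measure.volume_eq_prod]
  refine (lintegral_prod_symm' _ (hm.comp (joinTri hp.le).measurable)).trans ?_
  refine lintegral_congr fun w => ?_
  rw [← lintegral_const_mul' _ _ ENNReal.ofReal_ne_top]
  refine lintegral_congr fun l => ?_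
  rw [Function.comp_apply, obpDens_joinTri, mul_comm, ENNReal.ofReal_mul (upDens_nonneg ..)]

/-- The constant normalizing the multivariate Bessel function. -/
def besselConst (θ : ℝ) (N : ℕ) : ℝ :=
  (∏ k : Fin N, Real.Gamma ((k.1 + 1) * θ)) / Real.Gamma θ ^ (N * (N + 1) / 2)

lemma besselConst_pos {θ : ℝ} (hθ : 0 < θ) (N : ℕ) : 0 < besselConst θ N :=
  div_pos (Finset.prod_pos fun k _ => Real.Gamma_pos_of_pos (by positivity))
    (pow_pos (Real.Gamma_pos_of_pos hθ) _)

lemma besselConst_succ (θ : ℝ) (N : ℕ) :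
    besselConst θ (N + 1) =
      besselConst θ N * (Real.Gamma ((N + 1) * θ) / Real.Gamma θ ^ (N + 1)) := by
  have h : (N + 1) * (N + 1 + 1) / 2 = N * (N + 1) / 2 + (N + 1) := by
    rw [show (N + 1) * (N + 1 + 1) = N * (N + 1) + (N + 1) * 2 by ring,
      Nat.add_mul_div_right _ _ two_pos]
  rw [besselConst, besselConst, h, pow_add, Fin.prod_univ_castSucc, div_mul_div_comm]
  simp

/-- The total mass of the density `obpDens θ a`. -/
def obpMass (θ : ℝ) {N : ℕ} (a : Fin N → ℝ) : ℝ :=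
  (besselConst θ N)⁻¹ * absVdm a ^ (2 * θ - 1)

lemma obpMass_pos {θ : ℝ} (hθ : 0 < θ) {N : ℕ} {a : Fin N → ℝ} (ha : StrictAnti a) :
    0 < obpMass θ a :=
  mul_pos (inv_pos.2 (besselConst_pos hθ N)) (Real.rpow_pos_of_pos (absVdm_pos ha.injective) _)

/-- There is a single level above the `M`-th one in an array with `M + 1` levels. -/
instance uniqueTopLevel (M : ℕ) : Unique {k : Fin (M + 1) // ¬ k.1 < M} where
  default := ⟨⟨M, M.lt_succ_self⟩, lt_irrefl M⟩
  uniq k := Subtype.ext (Fin.ext (by have := k.2; have := k.1.2; simp only; omega))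

lemma lvl_top {M : ℕ} (a : Fin (M + 1) → ℝ) (x : Tri (M + 1 - 1)) :
    lvl a x M M.lt_succ_self = a := by
  have h : ¬ M < M + 1 - 1 := by omega
  simp only [lvl, h, dif_neg, not_false_eq_true]

lemma upDens_last (θ : ℝ) (M : ℕ) (a : Fin (M + 2) → ℝ) (w : UpTri M (M + 1)) :
    upDens θ M M.le_succ a w =
      {v | Interlaces v a}.indicator (fun v => adjWt θ v a) (w.bot M.lt_succ_self) := by
  have h := lvl_top a (joinTri M.le_succ (0, w))
  have hd : w ∈ upDomain M M.le_succ a ↔ w.bot M.lt_succ_self ∈ {v | Interlaces v a} := by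
    refine Unique.forall_iff.trans ?_
    change Interlaces (w.bot M.lt_succ_self) (lvl a (joinTri M.le_succ (0, w)) (M + 1) _) ↔ _
    rw [h]
    rfl
  unfold upDens
  by_cases hw : w ∈ upDomain M M.le_succ a
  · rw [Set.indicator_of_mem hw, Set.indicator_of_mem (hd.1 hw), Fintype.prod_unique]
    exact congrArg (adjWt θ _) h
  · rw [Set.indicator_of_notMem hw, Set.indicator_of_notMem fun h => hw (hd.2 h)]

lemma adjWt_mul_obpMass {θ : ℝ} {k : ℕ} {u : Fin (k + 1) → ℝ} (hu : StrictAnti u)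
    (b : Fin (k + 2) → ℝ) :
    adjWt θ u b * obpMass θ u = (besselConst θ (k + 1))⁻¹ * dixonWt θ b u := by
  have h : absVdm u ^ (2 - 2 * θ) * absVdm u ^ (2 * θ - 1) = absVdm u := by
    rw [← Real.rpow_add (absVdm_pos hu.injective)]
    norm_num
  rw [adjWt, absVdm_rpow, obpMass, dixonWt]
  linear_combination (besselConst θ (k + 1))⁻¹ *
    (∏ s : Fin (k + 2), ∏ r : Fin (k + 1), |b s - u r| ^ (θ - 1)) * h

lemma lintegral_obpDens {θ : ℝ} (hθ : 0 < θ) {M : ℕ} (a : Fin (M + 1) → ℝ) (ha : StrictAnti a) :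
    ∫⁻ x, ENNReal.ofReal (obpDens θ a x) = ENNReal.ofReal (obpMass θ a) := by
  induction M with
  | zero =>
    have h0 : ∀ x, obpDens θ a x = 1 := fun x => by
      rw [obpDens, Set.indicator_of_mem (fun k => k.elim0)]
      exact Finset.prod_empty
    have h1 : obpMass θ a = 1 := by
      have : absVdm a = 1 := by simp [absVdm]
      rw [obpMass, this, besselConst]
      simp [(Real.Gamma_pos_of_pos hθ).ne']
    simp only [h0, h1]
    rw [lintegral_const]
    have : (volume : Measure (Tri (0 + 1 - 1))) Set.univ = 1 := by
      have h : (volume : Measure (Tri 0)) = Measure.dirac isEmptyElim :=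
        Measure.volume_pi_eq_dirac _
      change (volume : Measure (Tri 0)) Set.univ = 1
      rw [h]; simp
    rw [this, mul_one]
  | succ M ih =>
    rw [lintegral_obpDens_eq θ M.lt_succ_self a]
    have hmp := (volume_preserving_piUnique
      (fun k : {k : Fin (M + 1) // ¬ k.1 < M} => Fin (k.1.1 + 1) → ℝ))
    have h1 := hmp.lintegral_comp_emb (MeasurableEquiv.measurableEmbedding _)
      (fun v : Fin (M + 1) → ℝ => ENNReal.ofReal
        ({v | Interlaces v a}.indicator (fun v => adjWt θ v a) v) *
          ∫⁻ l, ENNReal.ofReal (obpDens θ v l))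
    refine (lintegral_congr fun w => ?_).trans (h1.trans ?_)
    · rw [upDens_last]
      rfl
    have h2 : ∀ v : Fin (M + 1) → ℝ, ENNReal.ofReal
        ({v | Interlaces v a}.indicator (fun v => adjWt θ v a) v) *
          ∫⁻ l, ENNReal.ofReal (obpDens θ v l) =
        {v | Interlaces v a}.indicator (fun v => ENNReal.ofReal (besselConst θ (M + 1))⁻¹ *
          ENNReal.ofReal (dixonWt θ a v)) v := fun v => by
      by_cases hv : Interlaces v a
      · have hv' := hv.strictAnti
        rw [Set.indicator_of_mem hv, Set.indicator_of_mem hv, ih v hv',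
          ← ENNReal.ofReal_mul (adjWt_nonneg ..), adjWt_mul_obpMass hv',
          ENNReal.ofReal_mul (inv_pos.2 (besselConst_pos hθ _)).le]
      · rw [Set.indicator_of_notMem hv, Set.indicator_of_notMem hv, ENNReal.ofReal_zero, zero_mul]
    change ∫⁻ v : Fin (M + 1) → ℝ, _ = _
    rw [lintegral_congr h2, lintegral_indicator (measurableSet_interlaces a),
      lintegral_const_mul' _ _ ENNReal.ofReal_ne_top, lintegral_dixonWt hθ ha,
      ← ENNReal.ofReal_mul (inv_pos.2 (besselConst_pos hθ _)).le]
    congr 1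
    rw [obpMass, besselConst_succ θ (M + 1), mul_inv, inv_div, mul_assoc]

lemma integrable_obpDens {θ : ℝ} (hθ : 0 < θ) {M : ℕ} {a : Fin (M + 1) → ℝ} (ha : StrictAnti a) :
    Integrable (obpDens θ a) := by
  refine ⟨(measurable_obpDens_right θ a).aestronglyMeasurable, ?_⟩
  rw [hasFiniteIntegral_iff_ofReal (ae_of_all _ (obpDens_nonneg θ a)), lintegral_obpDens hθ a ha]
  exact ENNReal.ofReal_lt_top

lemma integral_obpDens {θ : ℝ} (hθ : 0 < θ) {M : ℕ} {a : Fin (M + 1) → ℝ} (ha : StrictAnti a) :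
    ∫ x, obpDens θ a x = obpMass θ a := by
  rw [integral_eq_lintegral_of_nonneg_ae (ae_of_all _ (obpDens_nonneg θ a))
    (measurable_obpDens_right θ a).aestronglyMeasurable, lintegral_obpDens hθ a ha,
    ENNReal.toReal_ofReal (obpMass_pos hθ ha).le]

/-- The exponential factor in the integral representation of the Bessel function. -/
def besselExp {N : ℕ} (a : Fin N → ℝ) (y : Fin N → ℂ) (x : Tri (N - 1)) : ℂ :=
  Complex.exp (∑ k : Fin N, y k * ((sumLvl a x (k.1 + 1) - sumLvl a x k.1 : ℝ) : ℂ))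

lemma sumLvl_succ {M : ℕ} (a : Fin (M + 1) → ℝ) (x : Tri (M + 1 - 1)) (k : ℕ) (hk : k < M + 1) :
    sumLvl a x (k + 1) = ∑ i, lvl a x k hk i := by
  by_cases h : k < M + 1 - 1
  · have h' : k + 1 - 1 < M + 1 - 1 := h
    simp only [sumLvl, lvl, h, h', dif_pos, k.succ_ne_zero, if_false]
    rfl
  · obtain rfl : k = M := by omega
    simp [sumLvl, lvl]

lemma measurable_sumLvl {N : ℕ} (k : ℕ) :
    Measurable fun q : (Fin N → ℝ) × Tri (N - 1) => sumLvl q.1 q.2 k := by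
  unfold sumLvl
  split_ifs <;> fun_prop

lemma measurable_besselExp {N : ℕ} (y : Fin N → ℂ) :
    Measurable fun q : (Fin N → ℝ) × Tri (N - 1) => besselExp q.1 y q.2 := by
  unfold besselExp
  refine Complex.measurable_exp.comp (Finset.measurable_sum _ fun k _ => ?_)
  exact (Complex.measurable_ofReal.comp
    ((measurable_sumLvl _).sub (measurable_sumLvl _))).const_mul _

lemma measurable_besselExp_mul_obpDens (θ : ℝ) {N : ℕ} (y : Fin N → ℂ) :
    Measurable fun q : (Fin N → ℝ) × Tri (N - 1) =>
      besselExp q.1 y q.2 * (obpDens θ q.1 q.2 : ℂ) :=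
  (measurable_besselExp y).mul (Complex.measurable_ofReal.comp (measurable_obpDens θ N))

lemma measurableSet_obpDomain {N : ℕ} (a : Fin N → ℝ) : MeasurableSet (obpDomain a) :=
  measurable_prodMk_left (x := a) (measurableSet_mem_obpDomain N)

lemma MBF_eq_integral (θ : ℝ) {N : ℕ} (a : Fin N → ℝ) (y : Fin N → ℂ) :
    MBF θ a y = ((besselConst θ N * absVdm a ^ (1 - 2 * θ) : ℝ) : ℂ) *
      ∫ x, besselExp a y x * (obpDens θ a x : ℂ) := by
  rw [MBF, absVdm_rpow, ← integral_indicator (measurableSet_obpDomain a), Complex.ofReal_mul]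
  refine congrArg₂ _ rfl (integral_congr_ae (ae_of_all _ fun x => ?_))
  by_cases hx : x ∈ obpDomain a
  · simp [hx, obpDens, besselExp]
  · simp [hx, obpDens]

lemma MBF_eq_inv_obpMass {θ : ℝ} {N : ℕ} {a : Fin N → ℝ} (ha : StrictAnti a) (y : Fin N → ℂ) :
    MBF θ a y = ((obpMass θ a : ℝ) : ℂ)⁻¹ * ∫ x, besselExp a y x * (obpDens θ a x : ℂ) := by
  rw [MBF_eq_integral, obpMass, ← Complex.ofReal_inv, mul_inv, inv_inv,
    ← Real.rpow_neg (absVdm_pos ha.injective).le, neg_sub]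

lemma stronglyMeasurable_MBF (θ : ℝ) {N : ℕ} (y : Fin N → ℂ) :
    StronglyMeasurable fun a : Fin N → ℝ => MBF θ a y := by
  simp only [MBF_eq_integral]
  refine StronglyMeasurable.mul ?_
    (measurable_besselExp_mul_obpDens θ y).stronglyMeasurable.integral_prod_right'
  refine (Complex.measurable_ofReal.comp (Measurable.const_mul ?_ _)).stronglyMeasurable
  exact (measurable_absVdm N).pow_const _

lemma abs_lvl_le {M : ℕ} {a : Fin (M + 1) → ℝ} {R : ℝ} (hR : ∀ i, |a i| ≤ R)
    {x : Tri (M + 1 - 1)} (hx : x ∈ obpDomain a) (k : ℕ) (hk : k < M + 1) (i : Fin (k + 1)) :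
    |lvl a x k hk i| ≤ R := by
  have hkM : k ≤ M := Nat.le_of_lt_succ hk
  induction hkM using Nat.decreasingInduction with
  | self => rw [lvl_top]; exact hR i
  | of_succ k hkM ih =>
    have h := hx ⟨k, hkM⟩ i
    have h' : lvl a x k hk i = x ⟨k, hkM⟩ i := by
      have : k < M + 1 - 1 := hkM
      simp only [lvl, this, dif_pos]
    rw [h']
    exact abs_le.2 ⟨(abs_le.1 (ih (Nat.succ_lt_succ hkM) i.succ)).1.trans h.2.le,
      h.1.le.trans (abs_le.1 (ih (Nat.succ_lt_succ hkM) i.castSucc)).2⟩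

lemma abs_sumLvl_le {M : ℕ} {a : Fin (M + 1) → ℝ} {R : ℝ} (hR : ∀ i, |a i| ≤ R)
    {x : Tri (M + 1 - 1)} (hx : x ∈ obpDomain a) (k : ℕ) (hk : k ≤ M + 1) :
    |sumLvl a x k| ≤ (M + 1) * R := by
  have hR0 : 0 ≤ R := (abs_nonneg _).trans (hR 0)
  cases k with
  | zero => simp only [sumLvl, if_true, abs_zero]; positivity
  | succ k =>
    rw [sumLvl_succ a x k hk]
    refine (Finset.abs_sum_le_sum_abs _ _).trans
      ((Finset.sum_le_card_nsmul _ _ R fun i _ => abs_lvl_le hR hx k hk i).trans ?_)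
    rw [Finset.card_univ, Fintype.card_fin, nsmul_eq_mul]
    gcongr
    exact_mod_cast hk

/-- A bound for `besselExp` in terms of a bound `R` for the top level. -/
def besselExpBound {M : ℕ} (y : Fin (M + 1) → ℂ) (R : ℝ) : ℝ :=
  Real.exp (∑ k, ‖y k‖ * (2 * ((M + 1) * R)))

lemma norm_besselExp_le {M : ℕ} {a : Fin (M + 1) → ℝ} {R : ℝ} (hR : ∀ i, |a i| ≤ R)
    (y : Fin (M + 1) → ℂ) {x : Tri (M + 1 - 1)} (hx : x ∈ obpDomain a) :
    ‖besselExp a y x‖ ≤ besselExpBound y R := by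
  rw [besselExp, besselExpBound, Complex.norm_exp]
  refine Real.exp_le_exp.2 ((Complex.re_le_norm _).trans ((norm_sum_le _ _).trans
    (Finset.sum_le_sum fun k _ => ?_)))
  rw [norm_mul, Complex.norm_real, Real.norm_eq_abs]
  gcongr
  have h1 := abs_sumLvl_le hR hx (k.1 + 1) k.2
  have h2 := abs_sumLvl_le hR hx k.1 k.2.le
  exact (abs_sub _ _).trans (by linarith)

lemma norm_besselExp_mul_obpDens_le (θ : ℝ) {M : ℕ} {a : Fin (M + 1) → ℝ} {R : ℝ}
    (hR : ∀ i, |a i| ≤ R) (y : Fin (M + 1) → ℂ) (x : Tri (M + 1 - 1)) :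
    ‖besselExp a y x * (obpDens θ a x : ℂ)‖ ≤ besselExpBound y R * obpDens θ a x := by
  by_cases hx : x ∈ obpDomain a
  · rw [norm_mul, Complex.norm_real, Real.norm_of_nonneg (obpDens_nonneg θ a x)]
    exact mul_le_mul_of_nonneg_right (norm_besselExp_le hR y hx) (obpDens_nonneg θ a x)
  · simp [obpDens, hx]

lemma norm_MBF_le {θ : ℝ} (hθ : 0 < θ) {M : ℕ} {a : Fin (M + 1) → ℝ} (ha : StrictAnti a) {R : ℝ}
    (hR : ∀ i, |a i| ≤ R) (y : Fin (M + 1) → ℂ) : ‖MBF θ a y‖ ≤ besselExpBound y R := by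
  have hZ := obpMass_pos hθ ha
  rw [MBF_eq_inv_obpMass ha, norm_mul, norm_inv, Complex.norm_real, Real.norm_of_nonneg hZ.le,
    inv_mul_le_iff₀ hZ]
  refine (norm_integral_le_of_norm_le ((integrable_obpDens hθ ha).const_mul _)
    (ae_of_all _ (norm_besselExp_mul_obpDens_le θ hR y))).trans_eq ?_
  rw [integral_const_mul, integral_obpDens hθ ha, mul_comm]

lemma exists_abs_le {N : ℕ} (a : Fin N → ℝ) : ∃ R, ∀ i, |a i| ≤ R :=
  ⟨‖a‖, fun i => norm_le_pi_norm a i⟩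

lemma integrable_besselExp_mul_obpDens {θ : ℝ} (hθ : 0 < θ) {M : ℕ} {a : Fin (M + 1) → ℝ}
    (ha : StrictAnti a) (y : Fin (M + 1) → ℂ) :
    Integrable fun x => besselExp a y x * (obpDens θ a x : ℂ) := by
  obtain ⟨R, hR⟩ := exists_abs_le a
  exact ((integrable_obpDens hθ ha).const_mul _).mono'
    ((measurable_besselExp_mul_obpDens θ y).comp measurable_prodMk_left).aestronglyMeasurable
    (ae_of_all _ (norm_besselExp_mul_obpDens_le θ hR y))

lemma measurable_levelProj {N m : ℕ} (h1 : 1 ≤ m) (h2 : m < N) :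
    Measurable (levelProj m h1 h2) := by
  unfold levelProj
  fun_prop

lemma integrable_obpDens_mul_MBF {θ : ℝ} (hθ : 0 < θ) {p M : ℕ} (hp : p < M)
    {a : Fin (M + 1) → ℝ} (ha : StrictAnti a) (y : Fin (p + 1) → ℂ) :
    Integrable fun x => (obpDens θ a x : ℂ) *
      MBF θ (levelProj (p + 1) p.succ_pos (Nat.succ_lt_succ hp) x) y := by
  obtain ⟨R, hR⟩ := exists_abs_le a
  refine ((integrable_obpDens hθ ha).mul_const (besselExpBound y R)).mono' ?_
    (ae_of_all _ fun x => ?_)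
  · exact (Complex.measurable_ofReal.comp (measurable_obpDens_right θ a)).aestronglyMeasurable.mul
      ((stronglyMeasurable_MBF θ y).comp_measurable (measurable_levelProj _ _)).aestronglyMeasurable
  · by_cases hx : x ∈ obpDomain a
    · rw [norm_mul, Complex.norm_real, Real.norm_of_nonneg (obpDens_nonneg θ a x)]
      refine mul_le_mul_of_nonneg_left (norm_MBF_le hθ ?_ (fun i => ?_) y) (obpDens_nonneg θ a x)
      · exact (hx ⟨p, hp⟩).strictAnti
      · have h := abs_lvl_le hR hx p (by omega) i
        have : p < M + 1 - 1 := hp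
        simp only [lvl, this, dif_pos] at h
        exact h
    · simp [obpDens, hx]

lemma sumLvl_joinTri {p M : ℕ} (hp : p < M) (a : Fin (M + 1) → ℝ) (l : Tri p)
    (w : UpTri p M) (k : ℕ) (hk : k ≤ p + 1) :
    sumLvl a (joinTri hp.le (l, w)) k = sumLvl (w.bot hp) l k := by
  cases k with
  | zero => simp [sumLvl]
  | succ k =>
    rw [sumLvl_succ a _ k (by omega), sumLvl_succ (w.bot hp) l k hk,
      lvl_joinTri_of_le hp a l w k (by omega)]

lemma besselExp_joinTri {p M : ℕ} (hp : p < M) (hpM : p + 1 ≤ M + 1) (a : Fin (M + 1) → ℝ)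
    (y : Fin (p + 1) → ℂ) (l : Tri p) (w : UpTri p M) :
    besselExp a (padC hpM y) (joinTri hp.le (l, w)) = besselExp (w.bot hp) y l := by
  unfold besselExp
  congr 1
  rw [← Finset.sum_subset (Finset.subset_univ (Finset.univ.map (Fin.castLEEmb hpM)))]
  · rw [Finset.sum_map]
    refine Finset.sum_congr rfl fun k _ => ?_
    have h1 := sumLvl_joinTri hp a l w (k.1 + 1) k.2
    have h2 := sumLvl_joinTri hp a l w k.1 k.2.le
    have h3 : (Fin.castLEEmb hpM k).1 < p + 1 := k.2
    simp only [padC, h3, dif_pos]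
    exact congrArg₂ (fun s t : ℝ => y k * ((s - t : ℝ) : ℂ)) h1 h2
  · intro k _ hk
    have : ¬ k.1 < p + 1 := fun h =>
      hk (Finset.mem_map.2 ⟨⟨k.1, h⟩, Finset.mem_univ _, rfl⟩)
    simp only [padC, this, dif_neg, not_false_eq_true, zero_mul]

lemma UpTri.strictAnti_bot {p M : ℕ} (hp : p < M) {a : Fin (M + 1) → ℝ} {w : UpTri p M}
    (hw : w ∈ upDomain p hp.le a) : StrictAnti (w.bot hp) :=
  (hw ⟨⟨p, hp⟩, lt_irrefl p⟩).strictAnti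

/-- Integration over a triangular array, the lower levels being integrated first. -/
lemma integral_joinTri {p M : ℕ} (hp : p ≤ M) {f : Tri M → ℂ} (hf : Integrable f) :
    ∫ x, f x = ∫ w, ∫ l, f (joinTri hp (l, w)) := by
  have hmp := measurePreserving_joinTri hp
  rw [← hmp.integral_comp' f, Measure.volume_eq_prod]
  refine integral_prod_symm _ ?_
  exact (hmp.integrable_comp_emb (joinTri hp).measurableEmbedding).2 hf

lemma integral_obpDens_mul_MBF {θ : ℝ} (hθ : 0 < θ) {p M : ℕ} (hp : p < M) (hpM : p + 1 ≤ M + 1)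
    {a : Fin (M + 1) → ℝ} (ha : StrictAnti a) (y : Fin (p + 1) → ℂ) :
    ∫ x, (obpDens θ a x : ℂ) *
      MBF θ (levelProj (p + 1) p.succ_pos (Nat.succ_lt_succ hp) x) y =
    ∫ x, besselExp a (padC hpM y) x * (obpDens θ a x : ℂ) := by
  refine (integral_joinTri hp.le (integrable_obpDens_mul_MBF hθ hp ha y)).trans
    (Eq.trans ?_ (integral_joinTri hp.le (integrable_besselExp_mul_obpDens hθ ha _)).symm)
  refine integral_congr_ae (ae_of_all _ fun w => ?_)
  have hproj : ∀ l, levelProj (p + 1) p.succ_pos (Nat.succ_lt_succ hp)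
      (joinTri hp.le (l, w)) = w.bot hp := fun l =>
    joinTri_of_not_lt hp.le l w ⟨p, hp⟩ (lt_irrefl p)
  have hL : ∀ l, (obpDens θ a (joinTri hp.le (l, w)) : ℂ) *
      MBF θ (levelProj (p + 1) p.succ_pos (Nat.succ_lt_succ hp) (joinTri hp.le (l, w))) y =
      (obpDens θ (w.bot hp) l : ℂ) * (upDens θ p hp.le a w * MBF θ (w.bot hp) y) := fun l => by
    rw [hproj, obpDens_joinTri, Complex.ofReal_mul, mul_assoc]
  have hR : ∀ l, besselExp a (padC hpM y) (joinTri hp.le (l, w)) *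
      (obpDens θ a (joinTri hp.le (l, w)) : ℂ) =
      besselExp (w.bot hp) y l * (obpDens θ (w.bot hp) l : ℂ) * upDens θ p hp.le a w :=
    fun l => by
      rw [besselExp_joinTri, obpDens_joinTri, Complex.ofReal_mul, mul_assoc]
  refine (integral_congr_ae (ae_of_all _ hL)).trans
    (Eq.trans ?_ (integral_congr_ae (ae_of_all _ hR)).symm)
  rw [integral_mul_const, integral_mul_const]
  by_cases hw : w ∈ upDomain p hp.le a
  · have hv := UpTri.strictAnti_bot hp hw
    have hZ : ((obpMass θ (w.bot hp) : ℝ) : ℂ) ≠ 0 :=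
      Complex.ofReal_ne_zero.2 (obpMass_pos hθ hv).ne'
    have hI : ∫ l, (obpDens θ (w.bot hp) l : ℂ) = (obpMass θ (w.bot hp) : ℂ) := by
      rw [integral_complex_ofReal, integral_obpDens hθ hv]
    rw [MBF_eq_inv_obpMass hv]
    refine (congrArg (fun z => z * _) hI).trans ?_
    rw [mul_left_comm, mul_inv_cancel_left₀ hZ, mul_comm]
    rfl
  · rw [upDens, Set.indicator_of_notMem hw, Complex.ofReal_zero, zero_mul, mul_zero, mul_zero]

lemma integral_obp {θ : ℝ} (hθ : 0 < θ) {M : ℕ} {a : Fin (M + 1) → ℝ} (ha : StrictAnti a)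
    (f : Tri (M + 1 - 1) → ℂ) :
    ∫ x, f x ∂(obp θ a) = ((obpMass θ a : ℝ) : ℂ)⁻¹ * ∫ x, (obpDens θ a x : ℂ) * f x := by
  have h : ∫ x in obpDomain a, obpWt θ a x = obpMass θ a := by
    rw [← integral_indicator (measurableSet_obpDomain a)]
    exact integral_obpDens hθ ha
  have hZ := obpMass_pos hθ ha
  rw [obp, h]
  change ∫ x, f x ∂((ENNReal.ofReal (obpMass θ a))⁻¹ •
    volume.withDensity fun x => ENNReal.ofReal (obpDens θ a x)) = _
  rw [integral_smul_measure, integral_withDensity_eq_integral_toReal_smul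
    (measurable_obpDens_right θ a).ennreal_ofReal (ae_of_all _ fun _ => ENNReal.ofReal_lt_top),
    ENNReal.toReal_inv, ENNReal.toReal_ofReal hZ.le, Complex.real_smul, Complex.ofReal_inv]
  refine congrArg _ (integral_congr_ae (ae_of_all _ fun x => ?_))
  simp only
  rw [ENNReal.toReal_ofReal (obpDens_nonneg θ a x), Complex.real_smul]

/-- (Proposition 4.1) Bessel observable of the orbital beta process:
`𝔼_{𝕄^{a(N),θ}_m}[𝓑_{(x₁,…,x_m)}(y₁,…,y_m;θ)] = 𝓑_{a(N)}(y₁,…,y_m,0^{N-m};θ)`. -/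
theorem mbf_observable_orbital
    (θ : ℝ) (hθ : 0 < θ) (m N : ℕ) (hm : 1 ≤ m) (hmN : m < N)
    (a : Fin N → ℝ) (ha : StrictAnti a) (y : Fin m → ℂ) :
    ∫ v, MBF θ v y ∂(Measure.map (levelProj m hm hmN) (obp θ a)) =
      MBF θ a (padC hmN.le y) := by
  obtain ⟨p, rfl⟩ : ∃ p, m = p + 1 := ⟨m - 1, by omega⟩
  obtain ⟨M, rfl⟩ : ∃ M, N = M + 1 := ⟨N - 1, by omega⟩
  rw [integral_map (measurable_levelProj hm hmN).aemeasurable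
    (stronglyMeasurable_MBF θ y).aestronglyMeasurable, integral_obp hθ ha,
    MBF_eq_inv_obpMass ha]
  exact congrArg _ (integral_obpDens_mul_MBF hθ (Nat.lt_of_succ_lt_succ hmN) hmN.le ha y)

end
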